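/- Let χ be a Dirichlet character (mod n) with conductor d (so d ∣ n). Then Σ_{k=1}^{n} gcd(k − 1, n) χ(k) = φ(n) · τ(n/d), where τ is the number-of-divisors function. -/

import Mathlib

open Finset

lemma ZMod.sum_Icc_natCast {M : Type*} [AddCommMonoid M] (n : ℕ) [NeZero n] (f : ZMod n → M) :
    ∑ k ∈ Icc 1 n, f k = ∑ a, f a := by
  have hn : 0 < n := Nat.pos_of_neZero n
  refine sum_bij (fun k _ => (k : ZMod n)) (fun _ _ => mem_univ _) ?_ ?_ (fun _ _ => rfl)
  · intro a ha b hb hab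
    rw [mem_Icc] at ha hb
    rw [ZMod.natCast_eq_natCast_iff] at hab
    have key : a - 1 ≡ b - 1 [MOD n] := by
      apply Nat.ModEq.add_right_cancel' 1
      rwa [Nat.sub_add_cancel ha.1, Nat.sub_add_cancel hb.1]
    have := key.eq_of_lt_of_lt (by lia) (by lia)
    lia
  · intro a _
    by_cases ha : a = 0
    · exact ⟨n, by simp [Nat.one_le_iff_ne_zero, hn.ne'], by simp [ha]⟩
    · refine ⟨a.val, ?_, ZMod.natCast_zmod_val a⟩
      have := (ZMod.val_ne_zero a).2 ha
      exact mem_Icc.2 ⟨by lia, (ZMod.val_lt a).le⟩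

lemma Int.gcd_sub_one_eq_sum_totient (n k : ℕ) (hn : n ≠ 0) :
    Int.gcd ((k : ℤ) - 1) n = ∑ e ∈ n.divisors, if (k : ZMod e) = 1 then e.totient else 0 := by
  rw [← Nat.sum_totient (Int.gcd _ _), ← sum_filter]
  refine sum_congr ?_ fun _ _ => rfl
  ext e
  have h : (k : ZMod e) = 1 ↔ (e : ℤ) ∣ k - 1 := by
    rw [← ZMod.intCast_zmod_eq_zero_iff_dvd, Int.cast_sub, sub_eq_zero]
    simp
  have hg : Int.gcd ((k : ℤ) - 1) n ≠ 0 := by simp [Int.gcd_eq_zero_iff, hn]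
  simp only [Nat.mem_divisors, mem_filter, h, Int.dvd_gcd_iff, Int.natCast_dvd_natCast]
  tauto

lemma ZMod.card_ker_unitsMap_mul_totient {n e : ℕ} [NeZero n] (he : e ∣ n) :
    Nat.card (ZMod.unitsMap he).ker * e.totient = n.totient := by
  have : NeZero e := ⟨ne_zero_of_dvd_ne_zero (NeZero.ne n) he⟩
  rw [← ZMod.card_units_eq_totient n, ← Nat.card_eq_fintype_card,
    ← (ZMod.unitsMap he).ker.card_mul_index, Subgroup.index_ker,
    MonoidHom.range_eq_top.2 (ZMod.unitsMap_surjective he), Subgroup.card_top,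
    Nat.card_eq_fintype_card (α := (ZMod e)ˣ), ZMod.card_units_eq_totient]

lemma DirichletCharacter.totient_mul_sum_eq_one {n e : ℕ} [NeZero n] (he : e ∣ n)
    (χ : DirichletCharacter ℂ n) :
    (e.totient : ℂ) * ∑ k ∈ Icc 1 n, (if (k : ZMod e) = 1 then χ k else 0) =
      if χ.conductor ∣ e then (n.totient : ℂ) else 0 := by
  classical
  have hsum : ∑ k ∈ Icc 1 n, (if (k : ZMod e) = 1 then χ k else 0) =
      ∑ u : (ZMod.unitsMap he).ker, χ (u : (ZMod n)ˣ) := by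
    have h1 := ZMod.sum_Icc_natCast n fun a => if ZMod.castHom he (ZMod e) a = 1 then χ a else 0
    simp only [map_natCast] at h1
    rw [h1, ← sum_filter]
    symm
    refine sum_of_injOn (fun u => ((u : (ZMod n)ˣ) : ZMod n)) ?_ ?_ ?_ (fun _ _ => rfl)
    · intro u _ v _ h
      exact Subtype.ext (Units.ext h)
    · intro u _
      exact mem_coe.2 (mem_filter.2 ⟨mem_univ _, congrArg Units.val (MonoidHom.mem_ker.1 u.2)⟩)
    · intro a ha hna
      refine χ.map_nonunit fun hu => hna ?_
      obtain ⟨u, rfl⟩ := hu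
      exact ⟨⟨u, MonoidHom.mem_ker.2 (Units.ext (mem_filter.1 ha).2)⟩, by simp, rfl⟩
  have hker : ((Units.coeHom ℂ).comp (χ.toUnitHom.comp (ZMod.unitsMap he).ker.subtype) = 1) ↔
      χ.conductor ∣ e := by
    rw [← mem_conductorSet_iff_conductor_dvd χ he, mem_conductorSet_iff,
      factorsThrough_iff_ker_unitsMap he]
    exact ⟨fun h u hu => Units.ext (by simpa using DFunLike.congr_fun h ⟨u, hu⟩),
      fun h => MonoidHom.ext fun u => congrArg Units.val (MonoidHom.mem_ker.1 (h u.2))⟩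
  have h2 := sum_hom_units ((Units.coeHom ℂ).comp
    (χ.toUnitHom.comp (ZMod.unitsMap he).ker.subtype))
  simp only [hker] at h2
  rw [hsum, ← ZMod.card_ker_unitsMap_mul_totient he, Nat.card_eq_fintype_card]
  have h3 : ∑ u : (ZMod.unitsMap he).ker, χ (u : (ZMod n)ˣ) =
      if χ.conductor ∣ e then (Fintype.card (ZMod.unitsMap he).ker : ℂ) else 0 := by
    simpa using h2
  rw [h3]
  split_ifs <;> push_cast <;> ring

lemma Nat.card_filter_dvd_divisors {n d : ℕ} (hn : n ≠ 0) (hd : d ∣ n) :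
    #{e ∈ n.divisors | d ∣ e} = #(n / d).divisors := by
  obtain ⟨m, rfl⟩ := hd
  have hd0 : 0 < d := Nat.pos_of_ne_zero (left_ne_zero_of_mul hn)
  have hm : m ≠ 0 := right_ne_zero_of_mul hn
  rw [Nat.mul_div_cancel_left m hd0]
  symm
  refine card_nbij (d * ·) ?_ ?_ ?_
  · intro e he
    simp_all [Nat.mul_dvd_mul_iff_left]
  · intro a _ b _ h
    exact Nat.eq_of_mul_eq_mul_left hd0 h
  · intro e he
    simp only [coe_filter, Nat.mem_divisors, Set.mem_ofPred_eq] at he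
    obtain ⟨⟨h, -⟩, c, rfl⟩ := he
    exact ⟨c, by simpa [hm] using Nat.dvd_of_mul_dvd_mul_left hd0 h, rfl⟩

/-- **Zhao–Cao identity**.  Let `χ` be a Dirichlet character (mod `n`) with conductor `d`
(so `d ∣ n`).  Then `∑_{k=1}^{n} gcd (k - 1) n · χ(k) = φ n · τ(n/d)`. -/
theorem zhao_cao_identity (n d : ℕ) (hn : 0 < n)
    (χ : DirichletCharacter ℂ n) (hcond : χ.conductor = d) (hd : d ∣ n) :
    ∑ k ∈ Finset.Icc 1 n, (Int.gcd ((k : ℤ) - 1) (n : ℤ) : ℂ) * χ (k : ZMod n)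
      = (Nat.totient n : ℂ) * ((n / d).divisors.card : ℂ) := by
  have : NeZero n := ⟨hn.ne'⟩
  calc
    _ = ∑ e ∈ n.divisors,
        (e.totient : ℂ) * ∑ k ∈ Icc 1 n, (if (k : ZMod e) = 1 then χ k else 0) := by
      simp_rw [Int.gcd_sub_one_eq_sum_totient n _ hn.ne', mul_sum, Nat.cast_sum, sum_mul]
      rw [sum_comm]
      refine sum_congr rfl fun e _ => sum_congr rfl fun k _ => ?_
      split_ifs <;> simp
    _ = ∑ e ∈ n.divisors, if d ∣ e then (n.totient : ℂ) else 0 := by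
      refine sum_congr rfl fun e he => ?_
      rw [χ.totient_mul_sum_eq_one (Nat.dvd_of_mem_divisors he), hcond]
    _ = _ := by
      rw [← sum_filter, sum_const, Nat.card_filter_dvd_divisors hn.ne' hd, nsmul_eq_mul, mul_comm]
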